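/- Let A ⋊ V ⋉ C be a two-sided crossed product afforded by two-sided crossed product data (A, V, C, R1, R2, R3, E) over a field k, and assume R1 is the flip map, R1(v⊗a) = a⊗v for all a∈A, v∈V. Transfer the algebra structure of A ⋊ V ⋉ C to V⊗(A⊗C) via the canonical linear isomorphism A⊗V⊗C ≅ V⊗A⊗C, obtaining the multiplication (v⊗(a⊗c))∗(v'⊗(a'⊗c')) = E_V(v, v'_{R2}) ⊗ (a a'_{R3} E_A(v, v'_{R2}) ⊗ E_C(v, v'_{R2})(c_{R3})_{R2}c'). Define P: (A⊗C)⊗V → V⊗(A⊗C) by P((a⊗c)⊗v) = v_{R2}⊗(a⊗c_{R2}) and ν: V⊗V → V⊗(A⊗C) by ν(v⊗v') = E_V(v,v')⊗(E_A(v,v')⊗E_C(v,v')). Then P and ν satisfy the mirror crossed product conditions with base algebra the twisted tensor product A⊗_{R3}C and vector space V with distinguished element 1_V, and ∗ is exactly the multiplication of the mirror crossed product V⊗̄_{P,ν}(A⊗_{R3}C). -/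

import Mathlib

open TensorProduct LinearMap

set_option maxHeartbeats 1000000
set_option synthInstance.maxHeartbeats 400000

noncomputable section

namespace TwoSidedCP

variable (k : Type*) [Field k]

/-- The associator as a linear map. -/
abbrev α (X Y Z : Type*) [AddCommGroup X] [Module k X] [AddCommGroup Y] [Module k Y]
    [AddCommGroup Z] [Module k Z] :
    (X ⊗[k] Y) ⊗[k] Z →ₗ[k] X ⊗[k] (Y ⊗[k] Z) :=
  (TensorProduct.assoc k X Y Z).toLinearMap

/-- The inverse associator as a linear map. -/
abbrev α' (X Y Z : Type*) [AddCommGroup X] [Module k X] [AddCommGroup Y] [Module k Y]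
    [AddCommGroup Z] [Module k Z] :
    X ⊗[k] (Y ⊗[k] Z) →ₗ[k] (X ⊗[k] Y) ⊗[k] Z :=
  (TensorProduct.assoc k X Y Z).symm.toLinearMap

/-- Multiplication `A ⊗ (A ⊗ V) → A ⊗ V` of the two `A`-factors. -/
def mulAV (A : Type*) [Ring A] [Algebra k A] (V : Type*) [AddCommGroup V] [Module k V] :
    A ⊗[k] (A ⊗[k] V) →ₗ[k] A ⊗[k] V :=
  rTensor V (mul' k A) ∘ₗ α' k A A V

/-- Multiplication `(X ⊗ C) ⊗ C → X ⊗ C` of the two `C`-factors. -/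
def mulXC (X : Type*) [AddCommGroup X] [Module k X] (C : Type*) [Ring C] [Algebra k C] :
    (X ⊗[k] C) ⊗[k] C →ₗ[k] X ⊗[k] C :=
  lTensor X (mul' k C) ∘ₗ α k X C C

section TwistingMaps
variable (A B : Type*) [Ring A] [Algebra k A] [Ring B] [Algebra k B]

/-- `R : B ⊗ A → A ⊗ B` is a twisting map between the algebras `A` and `B`:
  in Sweedler notation, `R(b ⊗ 1) = 1 ⊗ b`, `R(1 ⊗ a) = a ⊗ 1`,
  `(aa')_R ⊗ b_R = a_R a'_r ⊗ b_{R_r}` and `a_R ⊗ (bb')_R = a_{R_r} ⊗ b_r b'_R`. -/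
structure IsTwistingMap (R : B ⊗[k] A →ₗ[k] A ⊗[k] B) : Prop where
  unit_left : ∀ a : A, R ((1 : B) ⊗ₜ[k] a) = a ⊗ₜ[k] (1 : B)
  unit_right : ∀ b : B, R (b ⊗ₜ[k] (1 : A)) = (1 : A) ⊗ₜ[k] b
  mul_left : R ∘ₗ lTensor B (mul' k A) ∘ₗ α k B A A
      = rTensor B (mul' k A) ∘ₗ α' k A A B ∘ₗ lTensor A R ∘ₗ α k A B A ∘ₗ rTensor A R
  mul_right : R ∘ₗ rTensor A (mul' k B)
      = lTensor A (mul' k B) ∘ₗ α k A B B ∘ₗ rTensor B R ∘ₗ α' k B A B ∘ₗ lTensor B R ∘ₗ α k B B A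

/-- The multiplication `(a ⊗ b)(a' ⊗ b') = a a'_R ⊗ b_R b'` of the twisted tensor
  product `A ⊗_R B`. -/
def twistMul (R : B ⊗[k] A →ₗ[k] A ⊗[k] B) :
    (A ⊗[k] B) ⊗[k] (A ⊗[k] B) →ₗ[k] A ⊗[k] B :=
  TensorProduct.map (mul' k A) (mul' k B) ∘ₗ α' k A A (B ⊗[k] B) ∘ₗ lTensor A (α k A B B)
    ∘ₗ lTensor A (rTensor B R) ∘ₗ lTensor A (α' k B A B) ∘ₗ α k A B (A ⊗[k] B)

end TwistingMaps

section Brzezinski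
variable (A V : Type*) [Ring A] [Algebra k A] [AddCommGroup V] [Module k V]

/-- The Brzeziński crossed product conditions (brz1)-(brz5) for the data `(A, V, R, σ)`. -/
structure IsBrzData (e : V) (R : V ⊗[k] A →ₗ[k] A ⊗[k] V)
    (σ : V ⊗[k] V →ₗ[k] A ⊗[k] V) : Prop where
  brz1a : ∀ a : A, R (e ⊗ₜ[k] a) = a ⊗ₜ[k] e
  brz1b : ∀ v : V, R (v ⊗ₜ[k] (1 : A)) = (1 : A) ⊗ₜ[k] v
  brz2a : ∀ v : V, σ (e ⊗ₜ[k] v) = (1 : A) ⊗ₜ[k] v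
  brz2b : ∀ v : V, σ (v ⊗ₜ[k] e) = (1 : A) ⊗ₜ[k] v
  brz3 : R ∘ₗ lTensor V (mul' k A) ∘ₗ α k V A A
      = rTensor V (mul' k A) ∘ₗ α' k A A V ∘ₗ lTensor A R ∘ₗ α k A V A ∘ₗ rTensor A R
  brz4 : rTensor V (mul' k A) ∘ₗ α' k A A V ∘ₗ lTensor A σ ∘ₗ α k A V V ∘ₗ rTensor V R
        ∘ₗ α' k V A V ∘ₗ lTensor V σ ∘ₗ α k V V V
      = rTensor V (mul' k A) ∘ₗ α' k A A V ∘ₗ lTensor A σ ∘ₗ α k A V V ∘ₗ rTensor V σ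
  brz5 : rTensor V (mul' k A) ∘ₗ α' k A A V ∘ₗ lTensor A σ ∘ₗ α k A V V ∘ₗ rTensor V R
        ∘ₗ α' k V A V ∘ₗ lTensor V R ∘ₗ α k V V A
      = rTensor V (mul' k A) ∘ₗ α' k A A V ∘ₗ lTensor A R ∘ₗ α k A V A ∘ₗ rTensor A σ

/-- The multiplication `μ_{A⊗V} = (μ₂ ⊗ id_V)∘(id_A ⊗ id_A ⊗ σ)∘(id_A ⊗ R ⊗ id_V)`
  of the Brzeziński crossed product `A ⊗_{R,σ} V`. -/
def brzMul (R : V ⊗[k] A →ₗ[k] A ⊗[k] V) (σ : V ⊗[k] V →ₗ[k] A ⊗[k] V) :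
    (A ⊗[k] V) ⊗[k] (A ⊗[k] V) →ₗ[k] A ⊗[k] V :=
  rTensor V (mul' k A) ∘ₗ α' k A A V ∘ₗ rTensor (A ⊗[k] V) (mul' k A)
    ∘ₗ α' k A A (A ⊗[k] V) ∘ₗ lTensor A (lTensor A σ) ∘ₗ lTensor A (α k A V V)
    ∘ₗ lTensor A (rTensor V R) ∘ₗ lTensor A (α' k V A V) ∘ₗ α k A V (A ⊗[k] V)

end Brzezinski

section Mirror
variable (W B : Type*) [AddCommGroup W] [Module k W] [AddCommGroup B] [Module k B]

/-- The mirror crossed product conditions (mir0)-(mir4) for the data `(W, B, P, ν)`,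
  where the multiplication of `B` is given by `mB` with unit `uB`. -/
structure IsMirrorData (mB : B ⊗[k] B →ₗ[k] B) (uB : B) (e : W)
    (P : B ⊗[k] W →ₗ[k] W ⊗[k] B) (ν : W ⊗[k] W →ₗ[k] W ⊗[k] B) : Prop where
  mir0a : ∀ b : B, P (b ⊗ₜ[k] e) = e ⊗ₜ[k] b
  mir0b : ∀ w : W, P (uB ⊗ₜ[k] w) = w ⊗ₜ[k] uB
  mir1a : ∀ w : W, ν (w ⊗ₜ[k] e) = w ⊗ₜ[k] uB
  mir1b : ∀ w : W, ν (e ⊗ₜ[k] w) = w ⊗ₜ[k] uB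
  mir2 : P ∘ₗ rTensor W mB
      = lTensor W mB ∘ₗ α k W B B ∘ₗ rTensor B P ∘ₗ α' k B W B ∘ₗ lTensor B P ∘ₗ α k B B W
  mir3 : lTensor W mB ∘ₗ α k W B B ∘ₗ rTensor B ν ∘ₗ α' k W W B ∘ₗ lTensor W P
        ∘ₗ α k W B W ∘ₗ rTensor W ν
      = lTensor W mB ∘ₗ α k W B B ∘ₗ rTensor B ν ∘ₗ α' k W W B ∘ₗ lTensor W ν ∘ₗ α k W W W
  mir4 : lTensor W mB ∘ₗ α k W B B ∘ₗ rTensor B ν ∘ₗ α' k W W B ∘ₗ lTensor W P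
        ∘ₗ α k W B W ∘ₗ rTensor W P
      = lTensor W mB ∘ₗ α k W B B ∘ₗ rTensor B P ∘ₗ α' k B W B ∘ₗ lTensor B ν ∘ₗ α k B W W

/-- The multiplication `μ_{W⊗B} = (id_W ⊗ μ₂)∘(ν ⊗ id_B ⊗ id_B)∘(id_W ⊗ P ⊗ id_B)`
  of the mirror crossed product `W ⊗̄_{P,ν} B`. -/
def mirMul (mB : B ⊗[k] B →ₗ[k] B) (P : B ⊗[k] W →ₗ[k] W ⊗[k] B)
    (ν : W ⊗[k] W →ₗ[k] W ⊗[k] B) :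
    (W ⊗[k] B) ⊗[k] (W ⊗[k] B) →ₗ[k] W ⊗[k] B :=
  lTensor W mB ∘ₗ lTensor W (lTensor B mB) ∘ₗ α k W B (B ⊗[k] B)
    ∘ₗ rTensor (B ⊗[k] B) ν ∘ₗ α' k W W (B ⊗[k] B) ∘ₗ lTensor W (α k W B B)
    ∘ₗ lTensor W (rTensor B P) ∘ₗ lTensor W (α' k B W B) ∘ₗ α k W B (W ⊗[k] B)

end Mirror

section TwoSided
variable (A V C : Type*) [Ring A] [Algebra k A] [AddCommGroup V] [Module k V]
  [Ring C] [Algebra k C]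

/-- auxiliary map: multiply the leftover `A`-factor and `C`-factor into `A ⊗ V ⊗ C`. -/
def tsTail : (A ⊗[k] ((A ⊗[k] V) ⊗[k] C)) ⊗[k] C →ₗ[k] (A ⊗[k] V) ⊗[k] C :=
  mulXC k (A ⊗[k] V) C ∘ₗ rTensor C (rTensor C (mulAV k A V) ∘ₗ α' k A (A ⊗[k] V) C)

/-- Two-sided crossed product data `(A, V, C, R1, R2, R3, E)`:
  conditions (i)-(v) of Theorem 2.1 of the paper. -/
structure IsTwoSidedData (e : V) (R1 : V ⊗[k] A →ₗ[k] A ⊗[k] V)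
    (R2 : C ⊗[k] V →ₗ[k] V ⊗[k] C) (R3 : C ⊗[k] A →ₗ[k] A ⊗[k] C)
    (E : V ⊗[k] V →ₗ[k] (A ⊗[k] V) ⊗[k] C) : Prop where
  twist : IsTwistingMap k A C R3
  r1a : ∀ a : A, R1 (e ⊗ₜ[k] a) = a ⊗ₜ[k] e
  r1b : ∀ v : V, R1 (v ⊗ₜ[k] (1 : A)) = (1 : A) ⊗ₜ[k] v
  r2a : ∀ c : C, R2 (c ⊗ₜ[k] e) = e ⊗ₜ[k] c
  r2b : ∀ v : V, R2 ((1 : C) ⊗ₜ[k] v) = v ⊗ₜ[k] (1 : C)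
  ea : ∀ v : V, E (e ⊗ₜ[k] v) = ((1 : A) ⊗ₜ[k] v) ⊗ₜ[k] (1 : C)
  eb : ∀ v : V, E (v ⊗ₜ[k] e) = ((1 : A) ⊗ₜ[k] v) ⊗ₜ[k] (1 : C)
  eq1 : R1 ∘ₗ lTensor V (mul' k A) ∘ₗ α k V A A
      = rTensor V (mul' k A) ∘ₗ α' k A A V ∘ₗ lTensor A R1 ∘ₗ α k A V A ∘ₗ rTensor A R1
  eq2 : R2 ∘ₗ rTensor V (mul' k C)
      = lTensor V (mul' k C) ∘ₗ α k V C C ∘ₗ rTensor C R2 ∘ₗ α' k C V C ∘ₗ lTensor C R2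
        ∘ₗ α k C C V
  eq3 : lTensor A R2 ∘ₗ α k A C V ∘ₗ rTensor V R3 ∘ₗ α' k C A V ∘ₗ lTensor C R1
      = α k A V C ∘ₗ rTensor C R1 ∘ₗ α' k V A C ∘ₗ lTensor V R3 ∘ₗ α k V C A
        ∘ₗ rTensor A R2 ∘ₗ α' k C V A
  eq4 : rTensor C (mulAV k A V) ∘ₗ α' k A (A ⊗[k] V) C ∘ₗ lTensor A E ∘ₗ α k A V V
        ∘ₗ rTensor V R1 ∘ₗ α' k V A V ∘ₗ lTensor V R1 ∘ₗ α k V V A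
      = rTensor C (mulAV k A V) ∘ₗ rTensor C (lTensor A R1) ∘ₗ rTensor C (α k A V A)
        ∘ₗ α' k (A ⊗[k] V) A C ∘ₗ lTensor (A ⊗[k] V) R3 ∘ₗ α k (A ⊗[k] V) C A ∘ₗ rTensor A E
  eq5 : mulXC k (A ⊗[k] V) C ∘ₗ rTensor C E ∘ₗ α' k V V C ∘ₗ lTensor V R2
        ∘ₗ α k V C V ∘ₗ rTensor V R2
      = mulXC k (A ⊗[k] V) C ∘ₗ rTensor C (α' k A V C) ∘ₗ rTensor C (lTensor A R2)
        ∘ₗ rTensor C (α k A C V) ∘ₗ rTensor C (rTensor V R3) ∘ₗ rTensor C (α' k C A V)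
        ∘ₗ α' k C (A ⊗[k] V) C ∘ₗ lTensor C E ∘ₗ α k C V V
  eq6 : tsTail k A V C ∘ₗ rTensor C (lTensor A E) ∘ₗ rTensor C (α k A V V)
        ∘ₗ rTensor C (rTensor V R1) ∘ₗ rTensor C (α' k V A V)
        ∘ₗ α' k V (A ⊗[k] V) C ∘ₗ lTensor V E ∘ₗ α k V V V
      = tsTail k A V C ∘ₗ rTensor C (lTensor A E) ∘ₗ rTensor C (α k A V V)
        ∘ₗ α' k (A ⊗[k] V) V C ∘ₗ lTensor (A ⊗[k] V) R2 ∘ₗ α k (A ⊗[k] V) C V ∘ₗ rTensor V E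

/-- The map `P = (id_A ⊗ R2)∘(R3 ⊗ id_V) : C ⊗ (A ⊗ V) → (A ⊗ V) ⊗ C`. -/
def tsP (R2 : C ⊗[k] V →ₗ[k] V ⊗[k] C) (R3 : C ⊗[k] A →ₗ[k] A ⊗[k] C) :
    C ⊗[k] (A ⊗[k] V) →ₗ[k] (A ⊗[k] V) ⊗[k] C :=
  α' k A V C ∘ₗ lTensor A R2 ∘ₗ α k A C V ∘ₗ rTensor V R3 ∘ₗ α' k C A V

/-- The map `ν = (μ_A ⊗ id_V ⊗ id_C)∘(μ_A ⊗ E)∘(id_A ⊗ R1 ⊗ id_V)`,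
  `ν((a ⊗ v) ⊗ (a' ⊗ v')) = (a a'_{R1} E_A(v_{R1}, v') ⊗ E_V(v_{R1}, v')) ⊗ E_C(v_{R1}, v')`. -/
def tsNu (R1 : V ⊗[k] A →ₗ[k] A ⊗[k] V) (E : V ⊗[k] V →ₗ[k] (A ⊗[k] V) ⊗[k] C) :
    (A ⊗[k] V) ⊗[k] (A ⊗[k] V) →ₗ[k] (A ⊗[k] V) ⊗[k] C :=
  rTensor C (mulAV k A V) ∘ₗ α' k A (A ⊗[k] V) C ∘ₗ lTensor A (rTensor C (mulAV k A V))
    ∘ₗ lTensor A (α' k A (A ⊗[k] V) C) ∘ₗ lTensor A (lTensor A E) ∘ₗ lTensor A (α k A V V)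
    ∘ₗ lTensor A (rTensor V R1) ∘ₗ lTensor A (α' k V A V) ∘ₗ α k A V (A ⊗[k] V)

/-- The map `R = (R1 ⊗ id_C)∘(id_V ⊗ R3) : (V ⊗ C) ⊗ A → A ⊗ (V ⊗ C)`. -/
def tsR (R1 : V ⊗[k] A →ₗ[k] A ⊗[k] V) (R3 : C ⊗[k] A →ₗ[k] A ⊗[k] C) :
    (V ⊗[k] C) ⊗[k] A →ₗ[k] A ⊗[k] (V ⊗[k] C) :=
  α k A V C ∘ₗ rTensor C R1 ∘ₗ α' k V A C ∘ₗ lTensor V R3 ∘ₗ α k V C A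

/-- The map `σ = (id_A ⊗ id_V ⊗ μ_C)∘(E ⊗ μ_C)∘(id_V ⊗ R2 ⊗ id_C)`,
  `σ((v ⊗ c) ⊗ (v' ⊗ c')) = E_A(v, v'_{R2}) ⊗ (E_V(v, v'_{R2}) ⊗ E_C(v, v'_{R2}) c_{R2} c')`. -/
def tsSigma (R2 : C ⊗[k] V →ₗ[k] V ⊗[k] C) (E : V ⊗[k] V →ₗ[k] (A ⊗[k] V) ⊗[k] C) :
    (V ⊗[k] C) ⊗[k] (V ⊗[k] C) →ₗ[k] A ⊗[k] (V ⊗[k] C) :=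
  α k A V C ∘ₗ mulXC k (A ⊗[k] V) C ∘ₗ rTensor C E ∘ₗ α' k V V C
    ∘ₗ lTensor V (lTensor V (mul' k C)) ∘ₗ lTensor V (α k V C C)
    ∘ₗ lTensor V (rTensor C R2) ∘ₗ lTensor V (α' k C V C) ∘ₗ α k V C (V ⊗[k] C)

/-- The multiplication of the two-sided crossed product `A ⋊ V ⋉ C`:
  `(a ⊗ v ⊗ c)(a' ⊗ v' ⊗ c') = a (a'_{R3})_{R1} E_A(v_{R1}, v'_{R2}) ⊗ E_V(v_{R1}, v'_{R2})
    ⊗ E_C(v_{R1}, v'_{R2}) (c_{R3})_{R2} c'`. -/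
def tsMul (R1 : V ⊗[k] A →ₗ[k] A ⊗[k] V) (R2 : C ⊗[k] V →ₗ[k] V ⊗[k] C)
    (R3 : C ⊗[k] A →ₗ[k] A ⊗[k] C) (E : V ⊗[k] V →ₗ[k] (A ⊗[k] V) ⊗[k] C) :
    ((A ⊗[k] V) ⊗[k] C) ⊗[k] ((A ⊗[k] V) ⊗[k] C) →ₗ[k] (A ⊗[k] V) ⊗[k] C :=
  lTensor (A ⊗[k] V) (mul' k C) ∘ₗ α k (A ⊗[k] V) C C
    ∘ₗ rTensor C (tsNu k A V C R1 E) ∘ₗ α' k (A ⊗[k] V) (A ⊗[k] V) C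
    ∘ₗ lTensor (A ⊗[k] V) (lTensor (A ⊗[k] V) (mul' k C))
    ∘ₗ lTensor (A ⊗[k] V) (α k (A ⊗[k] V) C C)
    ∘ₗ lTensor (A ⊗[k] V) (rTensor C (tsP k A V C R2 R3))
    ∘ₗ lTensor (A ⊗[k] V) (α' k C (A ⊗[k] V) C)
    ∘ₗ α k (A ⊗[k] V) C ((A ⊗[k] V) ⊗[k] C)

/-- The canonical linear isomorphism `A ⊗ V ⊗ C ≅ V ⊗ (A ⊗ C)`. -/
def phiVAC : ((A ⊗[k] V) ⊗[k] C) ≃ₗ[k] V ⊗[k] (A ⊗[k] C) :=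
  (TensorProduct.congr (TensorProduct.comm k A V) (LinearEquiv.refl k C)).trans
    (TensorProduct.assoc k V A C)

end TwoSided

section Iterated
variable (A B C : Type*) [Ring A] [Algebra k A] [Ring B] [Algebra k B] [Ring C] [Algebra k C]

/-- The multiplication of the iterated twisted tensor product:
  `(a ⊗ b ⊗ c)(a' ⊗ b' ⊗ c') = a (a'_{R3})_{R1} ⊗ b_{R1} b'_{R2} ⊗ (c_{R3})_{R2} c'`. -/
def iterMul (R1 : B ⊗[k] A →ₗ[k] A ⊗[k] B) (R2 : C ⊗[k] B →ₗ[k] B ⊗[k] C)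
    (R3 : C ⊗[k] A →ₗ[k] A ⊗[k] C) :
    ((A ⊗[k] B) ⊗[k] C) ⊗[k] ((A ⊗[k] B) ⊗[k] C) →ₗ[k] (A ⊗[k] B) ⊗[k] C :=
  rTensor C (twistMul k A B R1) ∘ₗ α' k (A ⊗[k] B) (A ⊗[k] B) C
    ∘ₗ lTensor (A ⊗[k] B) (lTensor (A ⊗[k] B) (mul' k C))
    ∘ₗ lTensor (A ⊗[k] B) (α k (A ⊗[k] B) C C)
    ∘ₗ lTensor (A ⊗[k] B) (rTensor C (tsP k A B C R2 R3))
    ∘ₗ lTensor (A ⊗[k] B) (α' k C (A ⊗[k] B) C)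
    ∘ₗ α k (A ⊗[k] B) C ((A ⊗[k] B) ⊗[k] C)

end Iterated

section Statement15
variable (A V C : Type*) [Ring A] [Algebra k A] [AddCommGroup V] [Module k V]
  [Ring C] [Algebra k C]

/-- `P((a ⊗ c) ⊗ v) = v_{R2} ⊗ (a ⊗ c_{R2})`. -/
def flipP (R2 : C ⊗[k] V →ₗ[k] V ⊗[k] C) :
    (A ⊗[k] C) ⊗[k] V →ₗ[k] V ⊗[k] (A ⊗[k] C) :=
  α k V A C ∘ₗ rTensor C (TensorProduct.comm k A V).toLinearMap ∘ₗ α' k A V C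
    ∘ₗ lTensor A R2 ∘ₗ α k A C V

/-- `ν(v ⊗ v') = E_V(v, v') ⊗ (E_A(v, v') ⊗ E_C(v, v'))`. -/
def flipNu (E : V ⊗[k] V →ₗ[k] (A ⊗[k] V) ⊗[k] C) :
    V ⊗[k] V →ₗ[k] V ⊗[k] (A ⊗[k] C) :=
  α k V A C ∘ₗ rTensor C (TensorProduct.comm k A V).toLinearMap ∘ₗ E

section AuxLemmas
variable {k A V C}

/-- `(a ⊗ v) ⊗ c ↦ v ⊗ (a ⊗ c)` as a linear map. -/
def auxPhi : (A ⊗[k] V) ⊗[k] C →ₗ[k] V ⊗[k] (A ⊗[k] C) :=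
  α k V A C ∘ₗ rTensor C (TensorProduct.comm k A V).toLinearMap

lemma auxPhi_tmul (a : A) (v : V) (c : C) :
    auxPhi ((a ⊗ₜ[k] v) ⊗ₜ[k] c) = v ⊗ₜ[k] (a ⊗ₜ[k] c) := by
  simp [auxPhi]

lemma flipNu_apply (E : V ⊗[k] V →ₗ[k] (A ⊗[k] V) ⊗[k] C) (x : V ⊗[k] V) :
    flipNu k A V C E x = auxPhi (E x) := rfl

lemma flipP_tmul (R2 : C ⊗[k] V →ₗ[k] V ⊗[k] C) (a : A) (c : C) (v : V) :
    flipP k A V C R2 ((a ⊗ₜ[k] c) ⊗ₜ[k] v)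
      = lTensor V (TensorProduct.mk k A C a) (R2 (c ⊗ₜ[k] v)) := by
  simp only [flipP, LinearMap.comp_apply, LinearEquiv.coe_coe, assoc_tmul, lTensor_tmul]
  induction R2 (c ⊗ₜ[k] v) with
  | zero => simp
  | add x y hx hy => simp only [tmul_add, map_add, hx, hy]
  | tmul x y => simp

lemma twistMul_tmul (R3 : C ⊗[k] A →ₗ[k] A ⊗[k] C) (a a' : A) (c c' : C) :
    twistMul k A C R3 ((a ⊗ₜ[k] c) ⊗ₜ[k] (a' ⊗ₜ[k] c'))
      = TensorProduct.map (mulLeft k a) (mulRight k c') (R3 (c ⊗ₜ[k] a')) := by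
  simp only [twistMul, LinearMap.comp_apply, LinearEquiv.coe_coe, assoc_tmul, lTensor_tmul,
    assoc_symm_tmul, rTensor_tmul]
  induction R3 (c ⊗ₜ[k] a') with
  | zero => simp
  | add x y hx hy => simp only [tmul_add, add_tmul, map_add, hx, hy]
  | tmul x y => simp

/-- multiply the `A`-factor on the left and the `C`-factor on the right. -/
def auxLR (a : A) (c : C) : (A ⊗[k] V) ⊗[k] C →ₗ[k] (A ⊗[k] V) ⊗[k] C :=
  TensorProduct.map (rTensor V (mulLeft k a)) (mulRight k c)

lemma auxLR_tmul (a a' : A) (v : V) (c c' : C) :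
    auxLR a c ((a' ⊗ₜ[k] v) ⊗ₜ[k] c') = ((a * a') ⊗ₜ[k] v) ⊗ₜ[k] (c' * c) := by
  simp [auxLR]

lemma tsTail_tmul (a : A) (x : (A ⊗[k] V) ⊗[k] C) (c : C) :
    tsTail k A V C ((a ⊗ₜ[k] x) ⊗ₜ[k] c) = auxLR a c x := by
  induction x with
  | zero => simp
  | add x y hx hy => simp only [tmul_add, add_tmul, map_add, hx, hy]
  | tmul x y =>
    induction x with
    | zero => simp
    | add x y hx hy => simp only [tmul_add, add_tmul, map_add, hx, hy]
    | tmul x z => simp [tsTail, mulXC, mulAV, auxLR]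

/-- the key consequence of `eq4`. -/
lemma key4 (R1 : V ⊗[k] A →ₗ[k] A ⊗[k] V) (R3 : C ⊗[k] A →ₗ[k] A ⊗[k] C)
    (E : V ⊗[k] V →ₗ[k] (A ⊗[k] V) ⊗[k] C)
    (hR1 : ∀ (v : V) (a : A), R1 (v ⊗ₜ[k] a) = a ⊗ₜ[k] v)
    (eq4 : rTensor C (mulAV k A V) ∘ₗ α' k A (A ⊗[k] V) C ∘ₗ lTensor A E ∘ₗ α k A V V
        ∘ₗ rTensor V R1 ∘ₗ α' k V A V ∘ₗ lTensor V R1 ∘ₗ α k V V A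
      = rTensor C (mulAV k A V) ∘ₗ rTensor C (lTensor A R1) ∘ₗ rTensor C (α k A V A)
        ∘ₗ α' k (A ⊗[k] V) A C ∘ₗ lTensor (A ⊗[k] V) R3 ∘ₗ α k (A ⊗[k] V) C A ∘ₗ rTensor A E)
    (x : V ⊗[k] V) (a : A) (c : C) :
    lTensor V (twistMul k A C R3) (α k V (A ⊗[k] C) (A ⊗[k] C)
      (auxPhi (E x) ⊗ₜ[k] (a ⊗ₜ[k] c))) = auxPhi (auxLR a c (E x)) := by
  induction x with
  | zero => simp
  | add x y hx hy => simp only [add_tmul, map_add, hx, hy]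
  | tmul v w =>
    have h := congrArg (fun z => auxPhi (auxLR 1 c z)) (LinearMap.congr_fun eq4 ((v ⊗ₜ w) ⊗ₜ a))
    simp only [LinearMap.comp_apply, LinearEquiv.coe_coe, assoc_tmul, lTensor_tmul,
      assoc_symm_tmul, rTensor_tmul, hR1] at h
    generalize E (v ⊗ₜ[k] w) = y at h
    trans
    swap
    · trans
      · exact h.symm
      · clear h
        induction y with
        | zero => simp
        | add x y hx hy => simp only [tmul_add, add_tmul, map_add, hx, hy]
        | tmul x y =>
          induction x with
          | zero => simp
          | add x y hx hy => simp only [tmul_add, add_tmul, map_add, hx, hy]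
          | tmul x z => simp [mulAV, auxLR_tmul]
    · clear h
      induction y with
      | zero => simp
      | add x y hx hy => simp only [tmul_add, add_tmul, map_add, hx, hy]
      | tmul x y =>
        induction x with
        | zero => simp
        | add x y hx hy => simp only [tmul_add, add_tmul, map_add, hx, hy]
        | tmul x z =>
          simp only [auxPhi_tmul, LinearEquiv.coe_coe, assoc_tmul, lTensor_tmul, twistMul_tmul]
          induction R3 (y ⊗ₜ[k] a) with
          | zero => simp
          | add x y hx hy => simp only [tmul_add, add_tmul, map_add, hx, hy]
          | tmul x y => simp [mulAV, auxLR_tmul, auxPhi_tmul, hR1]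

/-- left and right multiplication on `V ⊗ (A ⊗ C)`. -/
def auxVLR (a : A) (c : C) : V ⊗[k] (A ⊗[k] C) →ₗ[k] V ⊗[k] (A ⊗[k] C) :=
  lTensor V (TensorProduct.map (mulLeft k a) (mulRight k c))

lemma auxVLR_tmul (a a' : A) (v : V) (c c' : C) :
    auxVLR a c (v ⊗ₜ[k] (a' ⊗ₜ[k] c')) = v ⊗ₜ[k] ((a * a') ⊗ₜ[k] (c' * c)) := by
  simp [auxVLR]

/-- the key consequence of `eq3`. -/
lemma key3 (R1 : V ⊗[k] A →ₗ[k] A ⊗[k] V) (R2 : C ⊗[k] V →ₗ[k] V ⊗[k] C)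
    (R3 : C ⊗[k] A →ₗ[k] A ⊗[k] C)
    (hR1 : ∀ (v : V) (a : A), R1 (v ⊗ₜ[k] a) = a ⊗ₜ[k] v)
    (eq3 : lTensor A R2 ∘ₗ α k A C V ∘ₗ rTensor V R3 ∘ₗ α' k C A V ∘ₗ lTensor C R1
      = α k A V C ∘ₗ rTensor C R1 ∘ₗ α' k V A C ∘ₗ lTensor V R3 ∘ₗ α k V C A
        ∘ₗ rTensor A R2 ∘ₗ α' k C V A) (c : C) (a : A) (v : V) :
    flipP k A V C R2 (R3 (c ⊗ₜ a) ⊗ₜ v)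
      = lTensor V R3 (α k V C A (R2 (c ⊗ₜ v) ⊗ₜ a)) := by
  have h := congrArg (fun z => auxPhi (α' k A V C z)) (LinearMap.congr_fun eq3 (c ⊗ₜ (v ⊗ₜ a)))
  simp only [LinearMap.comp_apply, LinearEquiv.coe_coe, assoc_tmul, lTensor_tmul,
      assoc_symm_tmul, rTensor_tmul, hR1] at h
  refine Eq.trans ?_ (h.trans ?_)
  · rfl
  · simp only [LinearEquiv.coe_coe]
    generalize lTensor V R3 _ = y
    induction y with
    | zero => simp
    | add x y hx hy => simp only [map_add, hx, hy]
    | tmul x y =>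
      induction y with
      | zero => simp
      | add x y hx hy => simp only [tmul_add, map_add, hx, hy]
      | tmul y z => simp [auxPhi_tmul, hR1]

/-- `(a ⊗ c)`-multiplication after `P`. -/
lemma keyP (R1 : V ⊗[k] A →ₗ[k] A ⊗[k] V) (R2 : C ⊗[k] V →ₗ[k] V ⊗[k] C)
    (R3 : C ⊗[k] A →ₗ[k] A ⊗[k] C)
    (hR1 : ∀ (v : V) (a : A), R1 (v ⊗ₜ[k] a) = a ⊗ₜ[k] v)
    (eq3 : lTensor A R2 ∘ₗ α k A C V ∘ₗ rTensor V R3 ∘ₗ α' k C A V ∘ₗ lTensor C R1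
      = α k A V C ∘ₗ rTensor C R1 ∘ₗ α' k V A C ∘ₗ lTensor V R3 ∘ₗ α k V C A
        ∘ₗ rTensor A R2 ∘ₗ α' k C V A) (a a' : A) (c c' : C) (v : V) :
    lTensor V (twistMul k A C R3) (α k V (A ⊗[k] C) (A ⊗[k] C)
      (flipP k A V C R2 ((a ⊗ₜ c) ⊗ₜ v) ⊗ₜ[k] (a' ⊗ₜ[k] c')))
      = auxVLR a c' (flipP k A V C R2 (R3 (c ⊗ₜ a') ⊗ₜ v)) := by
  rw [key3 R1 R2 R3 hR1 eq3, flipP_tmul]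
  induction R2 (c ⊗ₜ[k] v) with
  | zero => simp
  | add x y hx hy => simp only [add_tmul, map_add, hx, hy]
  | tmul x y => simp [twistMul_tmul, auxVLR]

/-- multiply by `C` on the right. -/
def auxM : (V ⊗[k] (A ⊗[k] C)) ⊗[k] C →ₗ[k] V ⊗[k] (A ⊗[k] C) :=
  lTensor V (mulXC k A C) ∘ₗ α k V (A ⊗[k] C) C

lemma auxM_tmul (x : V ⊗[k] (A ⊗[k] C)) (c : C) :
    auxM (x ⊗ₜ[k] c) = auxVLR 1 c x := by
  induction x with
  | zero => simp
  | add x y hx hy => simp only [add_tmul, map_add, hx, hy]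
  | tmul x y =>
    induction y with
    | zero => simp
    | add x y hx hy => simp only [tmul_add, add_tmul, map_add, hx, hy]
    | tmul y z => simp [auxM, mulXC, auxVLR]

lemma auxVLR_comp (a : A) (c : C) (x : V ⊗[k] (A ⊗[k] C)) :
    auxVLR a 1 (auxVLR 1 c x) = auxVLR a c x := by
  induction x with
  | zero => simp
  | add x y hx hy => simp only [map_add, hx, hy]
  | tmul x y =>
    induction y with
    | zero => simp
    | add x y hx hy => simp only [tmul_add, map_add, hx, hy]
    | tmul y z => simp [auxVLR]

/-- the key consequence of `eq2`. -/
lemma key2 (R2 : C ⊗[k] V →ₗ[k] V ⊗[k] C)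
    (eq2 : R2 ∘ₗ rTensor V (mul' k C)
      = lTensor V (mul' k C) ∘ₗ α k V C C ∘ₗ rTensor C R2 ∘ₗ α' k C V C ∘ₗ lTensor C R2
        ∘ₗ α k C C V) (a : A) (c : C) (v : V) (x : A ⊗[k] C) :
    flipP k A V C R2 (TensorProduct.map (mulLeft k a) (mulRight k c) x ⊗ₜ v)
      = auxVLR a 1 (auxM (rTensor C (flipP k A V C R2 ∘ₗ TensorProduct.mk k _ _ x)
          (R2 (c ⊗ₜ v)))) := by
  induction x with
  | zero => simp
  | add x y hx hy =>
    simp only [add_tmul, map_add, hx, hy, LinearMap.comp_add, rTensor_add, LinearMap.add_apply]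
  | tmul b d =>
    have h := LinearMap.congr_fun eq2 ((d ⊗ₜ c) ⊗ₜ v)
    simp only [LinearMap.comp_apply, LinearEquiv.coe_coe, assoc_tmul, lTensor_tmul,
      assoc_symm_tmul, rTensor_tmul, mul'_apply] at h
    simp only [map_tmul, mulLeft_apply, mulRight_apply, flipP_tmul, h]
    clear h
    induction R2 (c ⊗ₜ[k] v) with
    | zero => simp
    | add x y hx hy => simp only [tmul_add, map_add, hx, hy]
    | tmul x y =>
      simp only [assoc_symm_tmul, rTensor_tmul, LinearMap.comp_apply, TensorProduct.mk_apply,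
        auxM_tmul, auxVLR_comp, flipP_tmul]
      induction R2 (d ⊗ₜ[k] x) with
      | zero => simp
      | add x y hx hy => simp only [add_tmul, map_add, hx, hy]
      | tmul x y => simp [auxVLR]

/-- auxiliary map for comparing multiplications. -/
def auxG (E : V ⊗[k] V →ₗ[k] (A ⊗[k] V) ⊗[k] C) (v : V) :
    V ⊗[k] (A ⊗[k] C) →ₗ[k] V ⊗[k] (A ⊗[k] C) :=
  auxPhi ∘ₗ tsTail k A V C ∘ₗ rTensor C (lTensor A (E ∘ₗ TensorProduct.mk k V V v))
    ∘ₗ rTensor C (TensorProduct.comm k V A).toLinearMap ∘ₗ α' k V A C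

lemma auxG_tmul (E : V ⊗[k] V →ₗ[k] (A ⊗[k] V) ⊗[k] C) (v w : V) (a : A) (c : C) :
    auxG E v (w ⊗ₜ (a ⊗ₜ c)) = auxPhi (auxLR a c (E (v ⊗ₜ w))) := by
  simp [auxG, tsTail_tmul]

lemma assoc_nat {W B : Type*} [AddCommGroup W] [Module k W] [AddCommGroup B] [Module k B]
    (m : B ⊗[k] B →ₗ[k] B) (n : W ⊗[k] B) (t : B ⊗[k] B) :
    lTensor W (lTensor B m) (α k W B (B ⊗[k] B) (n ⊗ₜ t)) = α k W B B (n ⊗ₜ m t) := by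
  induction n with
  | zero => simp
  | add x y hx hy => simp only [add_tmul, map_add, hx, hy]
  | tmul x y => simp

lemma tsNu_tmul (R1 : V ⊗[k] A →ₗ[k] A ⊗[k] V) (E : V ⊗[k] V →ₗ[k] (A ⊗[k] V) ⊗[k] C)
    (hR1 : ∀ (v : V) (a : A), R1 (v ⊗ₜ[k] a) = a ⊗ₜ[k] v) (a a' : A) (v v' : V) :
    tsNu k A V C R1 E ((a ⊗ₜ v) ⊗ₜ (a' ⊗ₜ v')) = auxLR (a * a') 1 (E (v ⊗ₜ v')) := by
  simp only [tsNu, LinearMap.comp_apply, LinearEquiv.coe_coe, assoc_tmul, lTensor_tmul,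
      assoc_symm_tmul, rTensor_tmul, hR1]
  induction E (v ⊗ₜ[k] v') with
  | zero => simp
  | add x y hx hy => simp only [tmul_add, map_add, hx, hy]
  | tmul x y =>
    induction x with
    | zero => simp
    | add x y hx hy => simp only [tmul_add, add_tmul, map_add, hx, hy]
    | tmul x z => simp [mulAV, auxLR_tmul, mul_assoc]

lemma phiVAC_eq (x : (A ⊗[k] V) ⊗[k] C) : phiVAC k A V C x = auxPhi x := by
  induction x with
  | zero => simp
  | add x y hx hy => simp only [map_add, hx, hy]
  | tmul x y =>
    induction x with
    | zero => simp
    | add x y hx hy => simp only [add_tmul, map_add, hx, hy]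
    | tmul x z => simp [phiVAC, auxPhi_tmul]

lemma flipP_eq (R2 : C ⊗[k] V →ₗ[k] V ⊗[k] C) (R3 : C ⊗[k] A →ₗ[k] A ⊗[k] C)
    (c : C) (a : A) (v : V) :
    flipP k A V C R2 (R3 (c ⊗ₜ a) ⊗ₜ v) = auxPhi (tsP k A V C R2 R3 (c ⊗ₜ (a ⊗ₜ v))) := by
  simp [flipP, auxPhi, tsP]

lemma mul_left_side (R1 : V ⊗[k] A →ₗ[k] A ⊗[k] V) (R2 : C ⊗[k] V →ₗ[k] V ⊗[k] C)
    (R3 : C ⊗[k] A →ₗ[k] A ⊗[k] C) (E : V ⊗[k] V →ₗ[k] (A ⊗[k] V) ⊗[k] C)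
    (hR1 : ∀ (v : V) (a : A), R1 (v ⊗ₜ[k] a) = a ⊗ₜ[k] v)
    (a a' : A) (v v' : V) (c c' : C) :
    auxPhi (tsMul k A V C R1 R2 R3 E (((a ⊗ₜ v) ⊗ₜ c) ⊗ₜ ((a' ⊗ₜ v') ⊗ₜ c')))
      = auxG E v (auxVLR a c' (flipP k A V C R2 (R3 (c ⊗ₜ a') ⊗ₜ v'))) := by
  rw [flipP_eq]
  simp only [tsMul, LinearMap.comp_apply, LinearEquiv.coe_coe, assoc_tmul, lTensor_tmul,
      assoc_symm_tmul, rTensor_tmul]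
  induction tsP k A V C R2 R3 (c ⊗ₜ (a' ⊗ₜ v')) with
  | zero => simp
  | add x y hx hy => simp only [tmul_add, add_tmul, map_add, hx, hy]
  | tmul x y =>
    induction x with
    | zero => simp
    | add x y hx hy => simp only [tmul_add, add_tmul, map_add, hx, hy]
    | tmul x z =>
      simp only [assoc_tmul, lTensor_tmul, assoc_symm_tmul, rTensor_tmul, tsNu_tmul R1 E hR1,
        auxPhi_tmul, auxVLR_tmul, auxG_tmul, mul'_apply]
      induction E (v ⊗ₜ[k] z) with
      | zero => simp
      | add x y hx hy => simp only [add_tmul, map_add, hx, hy]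
      | tmul x y =>
        induction x with
        | zero => simp
        | add x y hx hy => simp only [add_tmul, map_add, hx, hy]
        | tmul x z => simp [auxLR_tmul]

end AuxLemmas


/-- if `R1` is the flip map, then `P` and `ν` as above satisfy the mirror
crossed product conditions with base the twisted tensor product algebra `A ⊗_{R3} C`
and vector space `V` with distinguished element `1_V`, and the multiplication of the
two-sided crossed product `A ⋊ V ⋉ C`, transferred to `V ⊗ (A ⊗ C)` along the
canonical isomorphism, is the mirror crossed product multiplication of
`V ⊗̄_{P,ν} (A ⊗_{R3} C)`. -/
theorem flip_R1_gives_mirror_crossed_product (e : V) (he : e ≠ 0)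
    (R1 : V ⊗[k] A →ₗ[k] A ⊗[k] V) (R2 : C ⊗[k] V →ₗ[k] V ⊗[k] C)
    (R3 : C ⊗[k] A →ₗ[k] A ⊗[k] C) (E : V ⊗[k] V →ₗ[k] (A ⊗[k] V) ⊗[k] C)
    (h : IsTwoSidedData k A V C e R1 R2 R3 E)
    (hR1 : ∀ (v : V) (a : A), R1 (v ⊗ₜ[k] a) = a ⊗ₜ[k] v) :
    IsMirrorData k V (A ⊗[k] C) (twistMul k A C R3) ((1 : A) ⊗ₜ[k] (1 : C)) e
        (flipP k A V C R2) (flipNu k A V C E) ∧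
    (phiVAC k A V C).toLinearMap ∘ₗ tsMul k A V C R1 R2 R3 E
        ∘ₗ TensorProduct.map (phiVAC k A V C).symm.toLinearMap
            (phiVAC k A V C).symm.toLinearMap
      = mirMul k V (A ⊗[k] C) (twistMul k A C R3) (flipP k A V C R2)
          (flipNu k A V C E) := by
  have K4 := key4 R1 R3 E hR1 h.eq4
  have KP := keyP R1 R2 R3 hR1 h.eq3
  refine ⟨⟨?_, ?_, ?_, ?_, ?_, ?_, ?_⟩, ?_⟩
  · intro b
    induction b with
    | zero => simp
    | add x y hx hy => simp only [tmul_add, add_tmul, map_add, hx, hy]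
    | tmul a c => simp [flipP_tmul, h.r2a]
  · intro w
    simp [flipP_tmul, h.r2b]
  · intro w
    simp [flipNu_apply, h.eb, auxPhi_tmul]
  · intro w
    simp [flipNu_apply, h.ea, auxPhi_tmul]
  · ext a c a' c' v
    simp only [AlgebraTensorModule.curry_apply, LinearMap.restrictScalars_self, curry_apply,
      LinearMap.comp_apply, LinearEquiv.coe_coe, assoc_tmul, lTensor_tmul,
      assoc_symm_tmul, rTensor_tmul, LinearMap.compr₂_apply, TensorProduct.mk_apply,
      twistMul_tmul, key2 R2 h.eq2]
    rw [flipP_tmul (a := a')]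
    induction R2 (c' ⊗ₜ[k] v) with
    | zero => simp
    | add x y hx hy => simp only [tmul_add, map_add, hx, hy]
    | tmul x y =>
      have := KP a a' c y x
      simp only [LinearEquiv.coe_coe] at this
      simp only [lTensor_tmul, rTensor_tmul, assoc_symm_tmul, TensorProduct.mk_apply,
        LinearMap.comp_apply, auxM_tmul, auxVLR_comp, this]
  · ext v w u
    have h6 := congrArg auxPhi (LinearMap.congr_fun h.eq6 ((v ⊗ₜ w) ⊗ₜ u))
    simp only [AlgebraTensorModule.curry_apply, LinearMap.restrictScalars_self, curry_apply,
      LinearMap.comp_apply, LinearEquiv.coe_coe, assoc_tmul, lTensor_tmul,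
      assoc_symm_tmul, rTensor_tmul, LinearMap.compr₂_apply, TensorProduct.mk_apply,
      flipNu_apply] at h6 ⊢
    refine Eq.trans ?_ (h6.symm.trans ?_)
    · induction E (v ⊗ₜ[k] w) with
      | zero => simp
      | add x y hx hy => simp only [add_tmul, map_add, hx, hy]
      | tmul x c =>
        induction x with
        | zero => simp
        | add x y hx hy => simp only [add_tmul, map_add, hx, hy]
        | tmul a z =>
          simp only [auxPhi_tmul, assoc_tmul, lTensor_tmul, flipP_tmul]
          induction R2 (c ⊗ₜ[k] u) with
          | zero => simp
          | add x y hx hy => simp only [tmul_add, map_add, hx, hy]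
          | tmul u' c' =>
            have := K4 (z ⊗ₜ u') a c'
            simp only [LinearEquiv.coe_coe] at this
            simp only [lTensor_tmul, rTensor_tmul, assoc_symm_tmul, assoc_tmul,
              TensorProduct.mk_apply, flipNu_apply, this, tsTail_tmul, LinearEquiv.coe_coe]
    · induction E (w ⊗ₜ[k] u) with
      | zero => simp
      | add x y hx hy => simp only [tmul_add, map_add, hx, hy]
      | tmul x c =>
        induction x with
        | zero => simp
        | add x y hx hy => simp only [tmul_add, add_tmul, map_add, hx, hy]
        | tmul a z =>
          have := K4 (v ⊗ₜ z) a c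
          simp only [LinearEquiv.coe_coe] at this
          simp only [auxPhi_tmul, lTensor_tmul, rTensor_tmul, assoc_symm_tmul, assoc_tmul,
            flipNu_apply, this, tsTail_tmul, hR1, LinearEquiv.coe_coe]
  · ext a c v w
    have h5 := congrArg (fun z => auxPhi (auxLR a 1 z))
      (LinearMap.congr_fun h.eq5 ((c ⊗ₜ v) ⊗ₜ w))
    simp only [AlgebraTensorModule.curry_apply, LinearMap.restrictScalars_self, curry_apply,
      LinearMap.comp_apply, LinearEquiv.coe_coe, assoc_tmul, lTensor_tmul,
      assoc_symm_tmul, rTensor_tmul, LinearMap.compr₂_apply, TensorProduct.mk_apply,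
      flipNu_apply, flipP_tmul] at h5 ⊢
    refine Eq.trans ?_ (h5.trans ?_)
    · induction R2 (c ⊗ₜ[k] v) with
      | zero => simp
      | add x y hx hy => simp only [add_tmul, map_add, hx, hy]
      | tmul v' c' =>
        simp only [assoc_tmul, lTensor_tmul, flipP_tmul, TensorProduct.mk_apply]
        induction R2 (c' ⊗ₜ[k] w) with
        | zero => simp
        | add x y hx hy => simp only [tmul_add, map_add, hx, hy]
        | tmul w' d =>
          have := K4 (v' ⊗ₜ w') a d
          simp only [LinearEquiv.coe_coe] at this
          simp only [lTensor_tmul, rTensor_tmul, assoc_symm_tmul, assoc_tmul,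
              TensorProduct.mk_apply, flipNu_apply, this]
          induction E (v' ⊗ₜ[k] w') with
          | zero => simp
          | add x y hx hy => simp only [add_tmul, map_add, hx, hy]
          | tmul x y =>
            induction x with
            | zero => simp
            | add x y hx hy => simp only [add_tmul, map_add, hx, hy]
            | tmul x z => simp [auxLR_tmul, mulXC]
    · induction E (v ⊗ₜ[k] w) with
      | zero => simp
      | add x y hx hy => simp only [tmul_add, map_add, hx, hy]
      | tmul x d =>
        induction x with
        | zero => simp
        | add x y hx hy => simp only [tmul_add, add_tmul, map_add, hx, hy]
        | tmul b z =>
          have := KP a b c d z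
          simp only [LinearEquiv.coe_coe] at this
          simp only [auxPhi_tmul, lTensor_tmul, rTensor_tmul, assoc_symm_tmul, this,
            LinearEquiv.coe_coe]
          induction R3 (c ⊗ₜ[k] b) with
          | zero => simp
          | add x y hx hy => simp only [add_tmul, map_add, hx, hy]
          | tmul b' c' =>
            simp only [flipP_tmul, assoc_tmul, lTensor_tmul]
            induction R2 (c' ⊗ₜ[k] z) with
            | zero => simp
            | add x y hx hy => simp only [tmul_add, add_tmul, map_add, hx, hy]
            | tmul z' c'' => simp [auxLR_tmul, auxVLR_tmul, auxPhi_tmul, mulXC]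
  · ext v a c v' a' c'
    have hs : ∀ (v : V) (a : A) (c : C),
        (phiVAC k A V C).symm (v ⊗ₜ (a ⊗ₜ c)) = (a ⊗ₜ v) ⊗ₜ c := by
      intro v a c
      rw [LinearEquiv.symm_apply_eq, phiVAC_eq, auxPhi_tmul]
    simp only [AlgebraTensorModule.curry_apply, LinearMap.restrictScalars_self, curry_apply,
      LinearMap.comp_apply, LinearEquiv.coe_coe, map_tmul, hs, phiVAC_eq,
      mul_left_side R1 R2 R3 E hR1, key3 R1 R2 R3 hR1 h.eq3]
    simp only [mirMul, LinearMap.comp_apply, LinearEquiv.coe_coe, assoc_tmul, lTensor_tmul,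
      assoc_symm_tmul, rTensor_tmul, flipP_tmul]
    induction R2 (c ⊗ₜ[k] v') with
    | zero => simp
    | add x y hx hy => simp only [tmul_add, add_tmul, map_add, hx, hy]
    | tmul w d =>
      have hn := assoc_nat (twistMul k A C R3) (flipNu k A V C E (v ⊗ₜ w))
        ((a ⊗ₜ d) ⊗ₜ (a' ⊗ₜ c'))
      simp only [LinearEquiv.coe_coe] at hn
      simp only [lTensor_tmul, rTensor_tmul, assoc_symm_tmul, assoc_tmul,
        TensorProduct.mk_apply, hn, twistMul_tmul]
      induction R3 (d ⊗ₜ[k] a') with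
      | zero => simp
      | add x y hx hy => simp only [tmul_add, map_add, hx, hy]
      | tmul b f =>
        have := K4 (v ⊗ₜ w) (a * b) (f * c')
        simp only [LinearEquiv.coe_coe] at this
        simp only [auxVLR_tmul, auxG_tmul, map_tmul, mulLeft_apply, mulRight_apply,
          flipNu_apply, this]

end Statement15
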